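/- arXiv:1410.4153 — 2 statements merged into one kernel-verified Lean document; each statement's English description precedes it below -/
import Mathlib

section
/- For every complex ζ and every τ in the complex upper half-plane, θ[1,3/5](τ)·θ[1/5,1/5](ζ,τ)²·θ[1/5,3/5](ζ,τ) + ζ₅²·θ[1,1/5](τ)·θ[1/5,3/5](ζ,τ)²·θ[1/5,9/5](ζ,τ) − ζ₅⁴·θ[1,3/5](τ)·θ[1/5,9/5](ζ,τ)²·θ[1/5,7/5](ζ,τ) − ζ₅²·θ[1,1/5](τ)·θ[1/5,7/5](ζ,τ)²·θ[1/5,1/5](ζ,τ) = 0. -/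
open Complex

/-- The theta function with characteristic `[ε; ε']`:
`θ[ε,ε'](ζ,τ) = ∑_{n ∈ ℤ} exp(2πi((1/2)(n+ε/2)²τ + (n+ε/2)(ζ+ε'/2)))`. -/
noncomputable def θf (ε ε' : ℝ) (ζ τ : ℂ) : ℂ :=
  ∑' n : ℤ, Complex.exp (2 * Real.pi * Complex.I *
    ((1 / 2) * ((n : ℂ) + (ε : ℂ) / 2) ^ 2 * τ + ((n : ℂ) + (ε : ℂ) / 2) * (ζ + (ε' : ℂ) / 2)))

/-- The theta constant: the value of the theta function at `ζ = 0`. -/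
noncomputable def θ (ε ε' : ℝ) (τ : ℂ) : ℂ := θf ε ε' 0 τ

/-- `ζ₅ = exp(2πi/5)`. -/
noncomputable def ζ₅ : ℂ := Complex.exp (2 * Real.pi * Complex.I / 5)

lemma θf_term_eq (ε ε' : ℝ) (ζ τ : ℂ) (n : ℤ) :
    Complex.exp (2 * Real.pi * Complex.I * ((1 / 2) * ((n : ℂ) + (ε : ℂ) / 2) ^ 2 * τ +
      ((n : ℂ) + (ε : ℂ) / 2) * (ζ + (ε' : ℂ) / 2))) =
    Complex.exp (2 * Real.pi * Complex.I * ((1 / 2) * ((ε : ℂ) / 2) ^ 2 * τ +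
      (ε : ℂ) / 2 * (ζ + (ε' : ℂ) / 2))) *
      jacobiTheta₂_term n (ζ + (ε' : ℂ) / 2 + (ε : ℂ) / 2 * τ) τ := by
  rw [jacobiTheta₂_term, ← Complex.exp_add]
  congr 1
  ring

lemma summable_norm_θf_term (ε ε' : ℝ) (ζ : ℂ) {τ : ℂ} (hτ : 0 < τ.im) :
    Summable fun n : ℤ => ‖Complex.exp (2 * Real.pi * Complex.I *
      ((1 / 2) * ((n : ℂ) + (ε : ℂ) / 2) ^ 2 * τ +
        ((n : ℂ) + (ε : ℂ) / 2) * (ζ + (ε' : ℂ) / 2)))‖ := by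
  simp only [θf_term_eq]
  exact (((summable_jacobiTheta₂_term_iff _ τ).2 hτ).mul_left _).norm

lemma θf_one_one_add_one (z τ : ℂ) : θf 1 1 (z + 1) τ = -θf 1 1 z τ := by
  rw [θf, θf, ← tsum_neg]
  refine tsum_congr fun n => ?_
  rw [← Complex.exp_add_pi_mul_I, Complex.exp_eq_exp_iff_exists_int]
  exact ⟨n, by push_cast; ring⟩

lemma θf_one_one_neg (z τ : ℂ) : θf 1 1 (-z) τ = -θf 1 1 z τ := by
  rw [θf, θf, ← tsum_neg, ← (Equiv.subLeft (-1 : ℤ)).tsum_eq]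
  refine tsum_congr fun n => ?_
  rw [← Complex.exp_add_pi_mul_I, Complex.exp_eq_exp_iff_exists_int]
  exact ⟨-n - 1, by simp only [Equiv.subLeft_apply]; push_cast; ring⟩

/-- A characteristic is absorbed into the argument of the odd theta function. -/
lemma θf_eq_exp_mul (ε ε' : ℝ) (ζ τ : ℂ) :
    θf ε ε' ζ τ = Complex.exp (2 * Real.pi * Complex.I * ((1 / 2) * (((ε : ℂ) - 1) / 2) ^ 2 * τ +
      ((ε : ℂ) - 1) / 2 * (ζ + (ε' : ℂ) / 2))) *
      θf 1 1 (ζ + ((ε' : ℂ) - 1) / 2 + ((ε : ℂ) - 1) / 2 * τ) τ := by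
  rw [θf, θf, ← tsum_mul_left]
  refine tsum_congr fun n => ?_
  rw [← Complex.exp_add]
  congr 1
  push_cast
  ring

lemma hasSum_θf_mul_θf (ε ε' δ δ' : ℝ) (z w : ℂ) {τ : ℂ} (hτ : 0 < τ.im) :
    HasSum (fun p : ℤ × ℤ =>
      Complex.exp (2 * Real.pi * Complex.I * ((1 / 2) * ((p.1 : ℂ) + (ε : ℂ) / 2) ^ 2 * τ +
        ((p.1 : ℂ) + (ε : ℂ) / 2) * (z + (ε' : ℂ) / 2))) *
      Complex.exp (2 * Real.pi * Complex.I * ((1 / 2) * ((p.2 : ℂ) + (δ : ℂ) / 2) ^ 2 * τ +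
        ((p.2 : ℂ) + (δ : ℂ) / 2) * (w + (δ' : ℂ) / 2))))
      (θf ε ε' z τ * θf δ δ' w τ) := by
  have hz := summable_norm_θf_term ε ε' z hτ
  have hw := summable_norm_θf_term δ δ' w hτ
  rw [θf, θf, tsum_mul_tsum_of_summable_norm hz hw]
  exact (summable_mul_of_summable_norm hz hw).hasSum

/-- Pairs of integers `(m, n)`, split by the parity of `m - n`. -/
lemma bijective_intPairs :
    Function.Bijective (Sum.elim (fun p : ℤ × ℤ => (p.1 + p.2, p.1 - p.2 - 1))
      (fun p : ℤ × ℤ => (p.1 + p.2, p.1 - p.2))) := by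
  constructor
  · rintro (⟨a, b⟩ | ⟨a, b⟩) (⟨c, d⟩ | ⟨c, d⟩) h <;>
      simp only [Sum.elim_inl, Sum.elim_inr, Prod.mk.injEq, Sum.inl.injEq, Sum.inr.injEq,
        reduceCtorEq] at h ⊢ <;> omega
  · rintro ⟨m, n⟩
    rcases Int.even_or_odd' (m - n) with ⟨k, h | h⟩
    · exact ⟨Sum.inr (m - k, k), by simp only [Sum.elim_inr, Prod.mk.injEq]; omega⟩
    · exact ⟨Sum.inl (m - k, k), by simp only [Sum.elim_inl, Prod.mk.injEq]; omega⟩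

/-- The addition formula expressing `θ₁(u+v) θ₁(u-v)` through theta functions for `2τ`. -/
lemma θf_one_one_add_mul_sub (u v : ℂ) {τ : ℂ} (hτ : 0 < τ.im) :
    θf 1 1 (u + v) τ * θf 1 1 (u - v) τ =
      θf 0 0 (2 * u) (2 * τ) * θf 1 0 (2 * v) (2 * τ) -
        θf 1 0 (2 * u) (2 * τ) * θf 0 0 (2 * v) (2 * τ) := by
  have hτ2 : 0 < (2 * τ).im := by simpa using hτ
  have hA := hasSum_θf_mul_θf 0 0 1 0 (2 * u) (2 * v) hτ2
  have hB := (hasSum_θf_mul_θf 1 0 0 0 (2 * u) (2 * v) hτ2).neg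
  refine (hasSum_θf_mul_θf 1 1 1 1 (u + v) (u - v) hτ).unique ?_
  rw [sub_eq_add_neg (_ * _), ← (Equiv.ofBijective _ bijective_intPairs).hasSum_iff]
  refine HasSum.sum ?_ ?_
  · convert hA using 2 with p
    simp only [Function.comp_apply, Equiv.ofBijective_apply, Sum.elim_inl]
    rw [← Complex.exp_add, ← Complex.exp_add, Complex.exp_eq_exp_iff_exists_int]
    exact ⟨p.1, by push_cast; ring⟩
  · convert! hB using 2 with p
    simp only [Function.comp_apply, Equiv.ofBijective_apply, Sum.elim_inr]
    rw [← Complex.exp_add, ← Complex.exp_add, ← Complex.exp_add_pi_mul_I,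
      Complex.exp_eq_exp_iff_exists_int]
    exact ⟨p.1, by push_cast; ring⟩

/-- Weierstrass' three-term relation, with one argument equal to zero. -/
lemma θf_one_one_three_term (w x y : ℂ) {τ : ℂ} (hτ : 0 < τ.im) :
    θf 1 1 (w + x) τ * θf 1 1 (w - x) τ * θf 1 1 y τ ^ 2 +
      θf 1 1 (x + y) τ * θf 1 1 (x - y) τ * θf 1 1 w τ ^ 2 +
      θf 1 1 (y + w) τ * θf 1 1 (y - w) τ * θf 1 1 x τ ^ 2 = 0 := by
  have hsq (t : ℂ) := θf_one_one_add_mul_sub t 0 hτ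
  simp only [add_zero, sub_zero, ← sq] at hsq
  rw [hsq, hsq, hsq, θf_one_one_add_mul_sub _ _ hτ, θf_one_one_add_mul_sub _ _ hτ,
    θf_one_one_add_mul_sub _ _ hτ]
  ring

lemma θf_one_one_fifth_quadratic (z : ℂ) {τ : ℂ} (hτ : 0 < τ.im) :
    θf 1 1 (2 / 5) τ * θf 1 1 (1 / 5) τ * θf 1 1 (z + 1 / 5) τ ^ 2 =
      θf 1 1 (z - 2 / 5) τ * θf 1 1 (z - 1 / 5) τ * θf 1 1 (1 / 5) τ ^ 2 +
      θf 1 1 (z + 2 / 5) τ * θf 1 1 z τ * θf 1 1 (2 / 5) τ ^ 2 := by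
  have h := θf_one_one_three_term (z + 1 / 5) (2 / 5) (1 / 5) hτ
  rw [show z + 1 / 5 + 2 / 5 = z - 2 / 5 + 1 by ring, show z + 1 / 5 - 2 / 5 = z - 1 / 5 by ring,
    show (2 / 5 + 1 / 5 : ℂ) = -(2 / 5) + 1 by ring, show (2 / 5 - 1 / 5 : ℂ) = 1 / 5 by ring,
    show 1 / 5 + (z + 1 / 5) = z + 2 / 5 by ring, show 1 / 5 - (z + 1 / 5) = -z by ring,
    θf_one_one_add_one, θf_one_one_add_one, θf_one_one_neg, θf_one_one_neg] at h
  linear_combination h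

lemma θf_one_one_fifth_cubic (z : ℂ) {τ : ℂ} (hτ : 0 < τ.im) :
    θf 1 1 (1 / 5) τ * (θf 1 1 (z - 2 / 5) τ ^ 2 * θf 1 1 (z - 1 / 5) τ -
      θf 1 1 (z + 2 / 5) τ ^ 2 * θf 1 1 (z + 1 / 5) τ) +
    θf 1 1 (2 / 5) τ * (θf 1 1 (z - 1 / 5) τ ^ 2 * θf 1 1 (z + 2 / 5) τ -
      θf 1 1 (z + 1 / 5) τ ^ 2 * θf 1 1 (z - 2 / 5) τ) = 0 := by
  by_cases ha : θf 1 1 (1 / 5) τ = 0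
  · have h0 (w : ℂ) : θf 1 1 (2 / 5) τ * (θf 1 1 (w + 2 / 5) τ * θf 1 1 w τ) = 0 := by
      have := θf_one_one_fifth_quadratic w hτ
      rw [ha] at this
      rw [← sq_eq_zero_iff]
      linear_combination (-(θf 1 1 (w + 2 / 5) τ * θf 1 1 w τ)) * this
    have h1 := h0 (z + 2 / 5)
    have h2 := h0 (z + 1 / 5)
    rw [show z + 2 / 5 + 2 / 5 = z - 1 / 5 + 1 by ring, θf_one_one_add_one] at h1
    rw [show z + 1 / 5 + 2 / 5 = z - 2 / 5 + 1 by ring, θf_one_one_add_one] at h2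
    rw [ha]
    linear_combination (-θf 1 1 (z - 1 / 5) τ) * h1 + θf 1 1 (z + 1 / 5) τ * h2
  · have h1 := θf_one_one_fifth_quadratic z hτ
    have h2 := θf_one_one_fifth_quadratic (-z) hτ
    rw [show -z + 1 / 5 = -(z - 1 / 5) by ring, show -z - 2 / 5 = -(z + 2 / 5) by ring,
      show -z - 1 / 5 = -(z + 1 / 5) by ring, show -z + 2 / 5 = -(z - 2 / 5) by ring,
      θf_one_one_neg, θf_one_one_neg, θf_one_one_neg, θf_one_one_neg, θf_one_one_neg] at h2
    refine (mul_eq_zero.1 (?_ : θf 1 1 (1 / 5) τ * _ = 0)).resolve_left ha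
    linear_combination (-θf 1 1 (z - 2 / 5) τ) * h1 + θf 1 1 (z + 2 / 5) τ * h2

lemma θ_one_eq (ε' : ℝ) (τ : ℂ) : θ 1 ε' τ = -θf 1 1 ((1 - (ε' : ℂ)) / 2) τ := by
  rw [θ, θf_eq_exp_mul, ← θf_one_one_neg]
  simp only [ofReal_one, sub_self, zero_div]
  ring_nf
  simp

theorem three_theta_onefifth (ζ : ℂ) (τ : ℂ) (hτ : 0 < τ.im) :
    θ 1 (3/5) τ * θf (1/5) (1/5) ζ τ ^ 2 * θf (1/5) (3/5) ζ τ + ζ₅ ^ 2 * θ 1 (1/5) τ * θf (1/5) (3/5) ζ τ ^ 2 * θf (1/5) (9/5) ζ τ - ζ₅ ^ 4 * θ 1 (3/5) τ * θf (1/5) (9/5) ζ τ ^ 2 * θf (1/5) (7/5) ζ τ - ζ₅ ^ 2 * θ 1 (1/5) τ * θf (1/5) (7/5) ζ τ ^ 2 * θf (1/5) (1/5) ζ τ = 0 := by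
  obtain ⟨η, hη⟩ : ∃ η, η = Complex.exp (-(2 * Real.pi * Complex.I / 25)) := ⟨_, rfl⟩
  have hζη : ζ₅ * η ^ 5 = 1 := by
    rw [hη, ζ₅, ← Complex.exp_nat_mul, ← Complex.exp_add, ← Complex.exp_zero]
    congr 1
    push_cast
    ring
  obtain ⟨E, hE⟩ : ∃ E, E = Complex.exp (2 * Real.pi * Complex.I * (2 / 25 * τ - 2 / 5 * ζ)) :=
    ⟨_, rfl⟩
  have hf (k : ℕ) : θf (1 / 5) (k / 5 : ℝ) ζ τ =
      E * η ^ k * θf 1 1 (ζ - 2 / 5 * τ + ((k : ℂ) - 5) / 10) τ := by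
    rw [θf_eq_exp_mul, hE, hη, ← Complex.exp_nat_mul, ← Complex.exp_add]
    congr 2 <;> push_cast <;> ring
  have h1 := hf 1
  have h3 := hf 3
  have h7 := hf 7
  have h9 := hf 9
  have hc := θf_one_one_fifth_cubic (ζ - 2 / 5 * τ) hτ
  have hθ1 := θ_one_eq (1 / 5) τ
  have hθ3 := θ_one_eq (3 / 5) τ
  norm_num [sub_eq_add_neg] at h1 h3 h7 h9 hθ1 hθ3 hc ⊢
  rw [h1, h3, h7, h9, hθ1, hθ3]
  generalize θf 1 1 (ζ + -(2 / 5 * τ) + -(2 / 5)) τ = p at hc ⊢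
  generalize θf 1 1 (ζ + -(2 / 5 * τ) + -(1 / 5)) τ = q at hc ⊢
  generalize θf 1 1 (ζ + -(2 / 5 * τ) + 1 / 5) τ = r at hc ⊢
  generalize θf 1 1 (ζ + -(2 / 5 * τ) + 2 / 5) τ = t at hc ⊢
  have h2 : ζ₅ ^ 2 * η ^ 10 = 1 := by linear_combination (ζ₅ * η ^ 5 + 1) * hζη
  have h4 : ζ₅ ^ 4 * η ^ 20 = 1 := by linear_combination (ζ₅ ^ 2 * η ^ 10 + 1) * h2
  linear_combination (-E ^ 3 * η ^ 5) * hc +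
    E ^ 3 * η ^ 5 * θf 1 1 (2 / 5) τ * (r ^ 2 * p - q ^ 2 * t) * h2 +
    E ^ 3 * η ^ 5 * θf 1 1 (1 / 5) τ * (t ^ 2 * r) * h4
end

section
/- For every complex ζ and every τ in the complex upper half-plane, θ[1,3/5](τ)·θ[1/5,1/5](ζ,τ)²·θ[1/5,9/5](ζ,τ) + ζ₅²·θ[1,1/5](τ)·θ[1/5,9/5](ζ,τ)²·θ[1/5,3/5](ζ,τ) − θ[1,3/5](τ)·θ[1/5,3/5](ζ,τ)²·θ[1/5,1](ζ,τ) + θ[1,1/5](τ)·θ[1/5,1](ζ,τ)²·θ[1/5,1/5](ζ,τ) = 0. -/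
open Complex

/-- The theta series `∑ exp(πi (n+α)² τ + 2πi (n+α) z)` with complex characteristic `α`. -/
noncomputable def thetaSeries (α z τ : ℂ) : ℂ :=
  ∑' n : ℤ, cexp (2 * Real.pi * I * ((1 / 2) * ((n : ℂ) + α) ^ 2 * τ + ((n : ℂ) + α) * z))

lemma θf_eq_thetaSeries (ε ε' : ℝ) (ζ τ : ℂ) :
    θf ε ε' ζ τ = thetaSeries (ε / 2) (ζ + ε' / 2) τ := rfl

lemma summable_norm_thetaSeries_term (α z : ℂ) {τ : ℂ} (hτ : 0 < τ.im) :
    Summable fun n : ℤ ↦ ‖cexp (2 * Real.pi * I *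
      ((1 / 2) * ((n : ℂ) + α) ^ 2 * τ + ((n : ℂ) + α) * z))‖ := by
  have h := (((summable_jacobiTheta₂_term_iff (z + α * τ) τ).2 hτ).mul_left
    (cexp (2 * Real.pi * I * ((1 / 2) * α ^ 2 * τ + α * z)))).norm
  refine h.congr fun n ↦ ?_
  rw [jacobiTheta₂_term, ← Complex.exp_add]
  congr 2
  ring

lemma thetaSeries_char_add_one (α z τ : ℂ) :
    thetaSeries (α + 1) z τ = thetaSeries α z τ := by
  unfold thetaSeries
  rw [← (Equiv.addRight (1 : ℤ)).tsum_eq (fun n : ℤ ↦ cexp (2 * Real.pi * I *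
    ((1 / 2) * ((n : ℂ) + α) ^ 2 * τ + ((n : ℂ) + α) * z)))]
  refine tsum_congr fun n ↦ ?_
  simp only [Equiv.coe_addRight]
  push_cast
  congr 1
  ring

lemma thetaSeries_add_one (α z τ : ℂ) :
    thetaSeries α (z + 1) τ = cexp (2 * Real.pi * I * α) * thetaSeries α z τ := by
  unfold thetaSeries
  rw [← tsum_mul_left]
  refine tsum_congr fun n ↦ ?_
  rw [← Complex.exp_add, Complex.exp_eq_exp_iff_exists_int]
  exact ⟨n, by ring⟩

/-- The map `(k, l) ↦ (k + l + e, k - l)` for `e ∈ {0, 1}` identifies two copies of `ℤ × ℤ`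
with `ℤ × ℤ`. -/
def parityEquiv : (ℤ × ℤ) ⊕ (ℤ × ℤ) ≃ ℤ × ℤ where
  toFun := Sum.elim (fun p ↦ (p.1 + p.2, p.1 - p.2)) (fun p ↦ (p.1 + p.2 + 1, p.1 - p.2))
  invFun p := if (p.1 + p.2) % 2 = 0 then .inl ((p.1 + p.2) / 2, (p.1 - p.2) / 2)
    else .inr ((p.1 + p.2) / 2, (p.1 - p.2) / 2)
  left_inv := by
    rintro (⟨k, l⟩ | ⟨k, l⟩)
    · have : (k + l + (k - l)) % 2 = 0 := by omega
      simp only [Sum.elim_inl, this, if_true, Sum.inl.injEq, Prod.mk.injEq]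
      omega
    · have : (k + l + 1 + (k - l)) % 2 ≠ 0 := by omega
      simp only [Sum.elim_inr, this, if_false, Sum.inr.injEq, Prod.mk.injEq]
      omega
  right_inv := by
    rintro ⟨m, n⟩
    by_cases h : (m + n) % 2 = 0
    · simp only [h, if_true, Sum.elim_inl, Prod.mk.injEq]
      omega
    · simp only [h, if_false, Sum.elim_inr, Prod.mk.injEq]
      omega

lemma thetaSeries_mul_thetaSeries (a b u v : ℂ) {τ : ℂ} (hτ : 0 < τ.im) :
    thetaSeries a u τ * thetaSeries b v τ =
      thetaSeries ((a + b) / 2) (u + v) (2 * τ) * thetaSeries ((a - b) / 2) (u - v) (2 * τ) +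
      thetaSeries ((a + b + 1) / 2) (u + v) (2 * τ) *
        thetaSeries ((a - b + 1) / 2) (u - v) (2 * τ) := by
  have h2τ : 0 < (2 * τ).im := by simpa using hτ
  have hs (α z : ℂ) := summable_norm_thetaSeries_term α z hτ
  have hs2 (α z : ℂ) := summable_norm_thetaSeries_term α z h2τ
  unfold thetaSeries
  rw [tsum_mul_tsum_of_summable_norm (hs _ _) (hs _ _),
    tsum_mul_tsum_of_summable_norm (hs2 _ _) (hs2 _ _),
    tsum_mul_tsum_of_summable_norm (hs2 _ _) (hs2 _ _), ← parityEquiv.tsum_eq]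
  have key := (parityEquiv.summable_iff.2 (summable_mul_of_summable_norm (hs a u) (hs b v)))
  refine ((key.comp_injective Sum.inl_injective).hasSum.sum
    (key.comp_injective Sum.inr_injective).hasSum).tsum_eq.trans ?_
  congr 1 <;> refine tsum_congr fun p ↦ ?_ <;>
  · simp only [parityEquiv, Function.comp_apply, Equiv.coe_fn_mk, Sum.elim_inl, Sum.elim_inr, ← Complex.exp_add]
    push_cast
    congr 1
    ring

lemma thetaSeries_add_mul_sub (a x y : ℂ) {τ : ℂ} (hτ : 0 < τ.im) :
    thetaSeries a (x + y) τ * thetaSeries a (x - y) τ =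
      thetaSeries a (2 * x) (2 * τ) * thetaSeries 0 (2 * y) (2 * τ) +
      thetaSeries (a + 1 / 2) (2 * x) (2 * τ) * thetaSeries (1 / 2) (2 * y) (2 * τ) := by
  rw [thetaSeries_mul_thetaSeries a a _ _ hτ]
  ring_nf

lemma thetaSeries_half_add_one (z τ : ℂ) :
    thetaSeries (1 / 2) (z + 1) τ = -thetaSeries (1 / 2) z τ := by
  rw [thetaSeries_add_one, show 2 * (Real.pi : ℂ) * I * (1 / 2) = Real.pi * I by ring,
    Complex.exp_pi_mul_I, neg_one_mul]

lemma thetaSeries_half_add_mul_sub (x y : ℂ) {τ : ℂ} (hτ : 0 < τ.im) :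
    thetaSeries (1 / 2) (x + y + 1 / 2) τ * thetaSeries (1 / 2) (x - y + 1 / 2) τ =
      thetaSeries 0 (2 * x) (2 * τ) * thetaSeries (1 / 2) (2 * y) (2 * τ) -
      thetaSeries (1 / 2) (2 * x) (2 * τ) * thetaSeries 0 (2 * y) (2 * τ) := by
  have h := thetaSeries_add_mul_sub (1 / 2) (x + 1 / 2) y hτ
  have h0 : thetaSeries 1 (2 * x + 1) (2 * τ) = thetaSeries 0 (2 * x) (2 * τ) := by
    rw [← zero_add 1, thetaSeries_char_add_one, zero_add, thetaSeries_add_one]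
    simp
  rw [show x + 1 / 2 + y = x + y + 1 / 2 by ring, show x + 1 / 2 - y = x - y + 1 / 2 by ring,
    show 2 * (x + 1 / 2) = 2 * x + 1 by ring, add_halves, h0, thetaSeries_half_add_one] at h
  rw [h]
  ring

/-- Weierstrass' three-term relation, with one arbitrary characteristic `a`. -/
lemma thetaSeries_three_term (a x y₀ y₁ y₂ : ℂ) {τ : ℂ} (hτ : 0 < τ.im) :
    thetaSeries a (x + y₀) τ * thetaSeries a (x - y₀) τ *
        (thetaSeries (1 / 2) (y₁ + y₂ + 1 / 2) τ * thetaSeries (1 / 2) (y₁ - y₂ + 1 / 2) τ) +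
      thetaSeries a (x + y₁) τ * thetaSeries a (x - y₁) τ *
        (thetaSeries (1 / 2) (y₂ + y₀ + 1 / 2) τ * thetaSeries (1 / 2) (y₂ - y₀ + 1 / 2) τ) +
      thetaSeries a (x + y₂) τ * thetaSeries a (x - y₂) τ *
        (thetaSeries (1 / 2) (y₀ + y₁ + 1 / 2) τ * thetaSeries (1 / 2) (y₀ - y₁ + 1 / 2) τ) =
      0 := by
  simp only [thetaSeries_add_mul_sub a x _ hτ, thetaSeries_half_add_mul_sub _ _ hτ]
  ring

lemma thetaSeries_half_neg (z τ : ℂ) :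
    thetaSeries (1 / 2) (-z) τ = thetaSeries (1 / 2) z τ := by
  unfold thetaSeries
  rw [← (Equiv.subLeft (-1 : ℤ)).tsum_eq (fun n : ℤ ↦ cexp (2 * Real.pi * I *
    ((1 / 2) * ((n : ℂ) + 1 / 2) ^ 2 * τ + ((n : ℂ) + 1 / 2) * z)))]
  refine tsum_congr fun n ↦ ?_
  simp only [Equiv.subLeft_apply]
  push_cast
  congr 1
  ring

/-- The three-term relation at the points `x`, `x ± 1/5`, `x ± 2/5`. -/
lemma thetaSeries_fifths (a x : ℂ) {τ : ℂ} (hτ : 0 < τ.im) :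
    thetaSeries (1 / 2) (1 / 10) τ ^ 2 *
        (thetaSeries a (x + 1 / 5) τ * thetaSeries a (x - 1 / 5) τ) =
      thetaSeries (1 / 2) (3 / 10) τ * thetaSeries (1 / 2) (1 / 10) τ * thetaSeries a x τ ^ 2 +
      thetaSeries (1 / 2) (3 / 10) τ ^ 2 *
        (thetaSeries a (x + 2 / 5) τ * thetaSeries a (x - 2 / 5) τ) := by
  have h := thetaSeries_three_term a x 0 (1 / 5) (2 / 5) hτ
  have h1 : thetaSeries (1 / 2) (1 / 5 + 2 / 5 + 1 / 2) τ = -thetaSeries (1 / 2) (1 / 10) τ := by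
    rw [← thetaSeries_half_add_one]; norm_num
  have h2 : thetaSeries (1 / 2) (1 / 5 - 2 / 5 + 1 / 2) τ = thetaSeries (1 / 2) (3 / 10) τ := by
    norm_num
  have h3 : thetaSeries (1 / 2) (2 / 5 + 1 / 2) τ = -thetaSeries (1 / 2) (1 / 10) τ := by
    rw [← thetaSeries_half_neg (1 / 10), ← thetaSeries_half_add_one]; norm_num
  have h4 : thetaSeries (1 / 2) (1 / 5 + 1 / 2) τ = -thetaSeries (1 / 2) (3 / 10) τ := by
    rw [← thetaSeries_half_neg (3 / 10), ← thetaSeries_half_add_one]; norm_num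
  have h5 : thetaSeries (1 / 2) (-(1 / 5) + 1 / 2) τ = thetaSeries (1 / 2) (3 / 10) τ := by
    norm_num
  simp only [add_zero, sub_zero, zero_add, zero_sub] at h
  rw [h1, h2, h3, h4, h5] at h
  linear_combination h

theorem three_theta_onefifth_second (ζ : ℂ) (τ : ℂ) (hτ : 0 < τ.im) :
    θ 1 (3/5) τ * θf (1/5) (1/5) ζ τ ^ 2 * θf (1/5) (9/5) ζ τ + ζ₅ ^ 2 * θ 1 (1/5) τ * θf (1/5) (9/5) ζ τ ^ 2 * θf (1/5) (3/5) ζ τ - θ 1 (3/5) τ * θf (1/5) (3/5) ζ τ ^ 2 * θf (1/5) 1 ζ τ + θ 1 (1/5) τ * θf (1/5) 1 ζ τ ^ 2 * θf (1/5) (1/5) ζ τ = 0 := by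
  set F : ℂ → ℂ := fun z ↦ thetaSeries (1 / 10) z τ with hF
  set A := thetaSeries (1 / 2) (3 / 10) τ with hA
  set B := thetaSeries (1 / 2) (1 / 10) τ with hB
  set r := cexp (2 * Real.pi * I * (1 / 10)) with hr
  have hr5 : r ^ 5 = -1 := by
    rw [hr, ← Complex.exp_nat_mul, ← Complex.exp_pi_mul_I]
    congr 1
    push_cast
    ring
  have hζ : ζ₅ = r ^ 2 := by
    rw [hr, ζ₅, ← Complex.exp_nat_mul]
    congr 1
    push_cast
    ring
  have hshift (z : ℂ) : F (z + 1) = r * F z := thetaSeries_add_one _ _ _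
  have hfifths (x : ℂ) : B ^ 2 * (F (x + 1 / 5) * F (x - 1 / 5)) =
      A * B * F x ^ 2 + A ^ 2 * (F (x + 2 / 5) * F (x - 2 / 5)) := thetaSeries_fifths _ x hτ
  have e1 : θ 1 (3/5) τ = A := by
    rw [θ, θf_eq_thetaSeries, hA]; push_cast; norm_num
  have e2 : θ 1 (1/5) τ = B := by
    rw [θ, θf_eq_thetaSeries, hB]; push_cast; norm_num
  have ea : θf (1/5) (1/5) ζ τ = F (ζ + 1 / 10) := by
    rw [θf_eq_thetaSeries, hF]; push_cast; norm_num
  have eb : θf (1/5) (3/5) ζ τ = F (ζ + 3 / 10) := by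
    rw [θf_eq_thetaSeries, hF]; push_cast; norm_num
  have ec : θf (1/5) 1 ζ τ = F (ζ + 1 / 2) := by
    rw [θf_eq_thetaSeries, hF]; push_cast; norm_num
  have ed : θf (1/5) (9/5) ζ τ = r * F (ζ - 1 / 10) := by
    rw [← hshift, θf_eq_thetaSeries, hF]; push_cast; ring_nf
  rw [e1, e2, ea, eb, ec, ed, hζ]
  by_cases hB0 : B = 0
  · by_cases hA0 : A = 0
    · simp [hA0, hB0]
    have hprod (x : ℂ) : F x * F (x - 1 / 5) = 0 := by
      have h := hfifths (x - 3 / 5)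
      have h1 := hshift (x - 1)
      rw [show x - 3 / 5 + 2 / 5 = x - 1 / 5 by ring,
        show x - 3 / 5 - 2 / 5 = x - 1 by ring] at h
      rw [sub_add_cancel] at h1
      have h2 : F (x - 1 / 5) * F (x - 1) = 0 := by simpa [hB0, hA0] using h
      linear_combination F (x - 1 / 5) * h1 + r * h2
    have h1 := hprod (ζ + 1 / 10)
    have h2 := hprod (ζ + 1 / 2)
    rw [show ζ + 1 / 10 - 1 / 5 = ζ - 1 / 10 by ring] at h1
    rw [show ζ + 1 / 2 - 1 / 5 = ζ + 3 / 10 by ring] at h2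
    rw [hB0]
    linear_combination A * r * F (ζ + 1 / 10) * h1 - A * F (ζ + 3 / 10) * h2
  · have h1 := hfifths (ζ + 1 / 10)
    have h2 := hfifths (ζ + 3 / 10)
    have h3 := hshift (ζ - 3 / 10)
    rw [show ζ + 1 / 10 + 1 / 5 = ζ + 3 / 10 by ring, show ζ + 1 / 10 - 1 / 5 = ζ - 1 / 10 by ring,
      show ζ + 1 / 10 + 2 / 5 = ζ + 1 / 2 by ring,
      show ζ + 1 / 10 - 2 / 5 = ζ - 3 / 10 by ring] at h1
    rw [show ζ + 3 / 10 + 1 / 5 = ζ + 1 / 2 by ring, show ζ + 3 / 10 - 1 / 5 = ζ + 1 / 10 by ring,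
      show ζ + 3 / 10 + 2 / 5 = ζ - 3 / 10 + 1 by ring,
      show ζ + 3 / 10 - 2 / 5 = ζ - 1 / 10 by ring, h3] at h2
    apply mul_left_cancel₀ hB0
    linear_combination (-r * F (ζ - 1 / 10)) * h1 + F (ζ + 1 / 2) * h2 +
      B ^ 2 * r * F (ζ - 1 / 10) ^ 2 * F (ζ + 3 / 10) * hr5
end
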